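/- Let A be the operator defined on locally integrable functions φ on [a,b] by (Aφ)(t) = g(t) ∫_a^t ψ'(τ)(ψ(t) − ψ(τ))^(α−1) φ(τ) dτ, where g is continuous, nonnegative and nondecreasing, ψ is C¹ increasing with ψ' ≠ 0, and α > 0. Then for every nonnegative integrable function u and every k ≥ 1, (A^k u)(t) ≤ ∫_a^t [g(t)Γ(α)]^k / Γ(αk) · ψ'(τ)(ψ(t) − ψ(τ))^(αk−1) u(τ) dτ. -/

import Mathlib

open MeasureTheory Real Set

noncomputable def gronOp (a α : ℝ) (g ψ : ℝ → ℝ) (φ : ℝ → ℝ) : ℝ → ℝ :=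
  fun t => g t * ∫ τ in a..t, deriv ψ τ * (ψ t - ψ τ) ^ (α - 1) * φ τ


open scoped ENNReal

structure GoodPsi (a b : ℝ) (ψ p : ℝ → ℝ) : Prop where
  mψ : Measurable ψ
  mp : Measurable p
  mono : StrictMonoOn ψ (Icc a b)
  cont : ContinuousOn ψ (Icc a b)
  hd : ∀ x ∈ Ioo a b, HasDerivAt ψ (p x) x
  pos : ∀ x ∈ Ioo a b, 0 < p x
  bdd : ∃ M : ℝ, ∀ x ∈ Ioo a b, p x ≤ M

noncomputable def fracJ (ψ p : ℝ → ℝ) (c β : ℝ) (U : ℝ → ℝ≥0∞) (t : ℝ) : ℝ≥0∞ :=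
  ∫⁻ s in Ioo c t, ENNReal.ofReal (p s) * (ENNReal.ofReal ((ψ t - ψ s) ^ (β - 1)) * U s)

theorem beta_kernel {a b : ℝ} {ψ p : ℝ → ℝ} (h : GoodPsi a b ψ p) {α β : ℝ} (hα : 0 < α)
    (hβ : 0 < β) {s t : ℝ} (has : a ≤ s) (hst : s < t) (htb : t ≤ b) :
    ∫⁻ x in Ioo s t, ENNReal.ofReal (p x) *
      (ENNReal.ofReal ((ψ t - ψ x) ^ (α - 1)) * ENNReal.ofReal ((ψ x - ψ s) ^ (β - 1)))
      = ENNReal.ofReal (ProbabilityTheory.beta α β * (ψ t - ψ s) ^ (α + β - 1)) := by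
  have hsm : s ∈ Icc a b := ⟨has, by linarith⟩
  have htm : t ∈ Icc a b := ⟨by linarith, htb⟩
  have hD : 0 < ψ t - ψ s := sub_pos.2 (h.mono hsm htm hst)
  set D := ψ t - ψ s with hDdef
  have hB := ProbabilityTheory.beta_pos hβ hα
  have hBsymm : ProbabilityTheory.beta α β = ProbabilityTheory.beta β α := by
    simp [ProbabilityTheory.beta, mul_comm, add_comm]
  have hsub : Ioo s t ⊆ Ioo a b := Ioo_subset_Ioo has htb
  have hinj : InjOn (fun x => (ψ x - ψ s) / D) (Ioo s t) := by
    intro x hx y hy hxy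
    have hx' := Ioo_subset_Icc_self (hsub hx)
    have hy' := Ioo_subset_Icc_self (hsub hy)
    apply h.mono.injOn hx' hy'
    simp only at hxy
    field_simp at hxy
    linarith
  have himg : (fun x => (ψ x - ψ s) / D) '' (Ioo s t) = Ioo 0 1 := by
    apply Subset.antisymm
    · rintro _ ⟨x, hx, rfl⟩
      have hx' := Ioo_subset_Icc_self (hsub hx)
      have h1 := h.mono hsm hx' hx.1
      have h2 := h.mono hx' htm hx.2
      constructor
      · exact div_pos (by linarith) hD
      · simp only; rw [div_lt_one hD]; linarith
    · have hc : ContinuousOn (fun x => (ψ x - ψ s) / D) (Icc s t) :=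
        ((h.cont.mono (Icc_subset_Icc has htb)).sub continuousOn_const).div_const _
      have := intermediate_value_Ioo hst.le hc
      simpa [← hDdef, hD.ne'] using this
  have key := lintegral_image_eq_lintegral_abs_deriv_mul (s := Ioo s t)
    (f := fun x => (ψ x - ψ s) / D) (f' := fun x => p x / D) measurableSet_Ioo
    (fun x hx => (((h.hd x (hsub hx)).sub_const _).div_const D).hasDerivWithinAt) hinj
    (fun y => ENNReal.ofReal (1 / ProbabilityTheory.beta β α * y ^ (β - 1) * (1 - y) ^ (α - 1)))
  rw [himg, ← ProbabilityTheory.lintegral_betaPDF,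
    ProbabilityTheory.lintegral_betaPDF_eq_one hβ hα] at key
  have hpw : 0 < D ^ (α + β - 1) := rpow_pos_of_pos hD _
  have e : ∀ x ∈ Ioo s t, ENNReal.ofReal (p x) *
      (ENNReal.ofReal ((ψ t - ψ x) ^ (α - 1)) * ENNReal.ofReal ((ψ x - ψ s) ^ (β - 1)))
      = ENNReal.ofReal (ProbabilityTheory.beta β α * D ^ (α + β - 1)) *
        (ENNReal.ofReal |p x / D| * ENNReal.ofReal (1 / ProbabilityTheory.beta β α *
          ((ψ x - ψ s) / D) ^ (β - 1) * (1 - (ψ x - ψ s) / D) ^ (α - 1))) := by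
    intro x hx
    have hx' := Ioo_subset_Icc_self (hsub hx)
    have h1 := h.mono hsm hx' hx.1
    have h2 := h.mono hx' htm hx.2
    have hp := h.pos x (hsub hx)
    have e1 : 1 - (ψ x - ψ s) / D = (ψ t - ψ x) / D := by
      field_simp; rw [hDdef]; ring
    rw [e1, abs_of_pos (div_pos hp hD), div_rpow (by linarith) hD.le,
      div_rpow (by linarith) hD.le]
    have hA := rpow_pos_of_pos (sub_pos.2 h1) (β - 1)
    have hC := rpow_pos_of_pos (sub_pos.2 h2) (α - 1)
    rw [← ENNReal.ofReal_mul hC.le, ← ENNReal.ofReal_mul hp.le, ← ENNReal.ofReal_mul (by positivity),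
      ← ENNReal.ofReal_mul (by positivity)]
    congr 1
    have e2 : D ^ (α + β - 1) = D * D ^ (α - 1) * D ^ (β - 1) := by
      rw [show α + β - 1 = 1 + (α - 1) + (β - 1) by ring, rpow_add hD, rpow_add hD, rpow_one]
    have := rpow_pos_of_pos hD (α - 1)
    have := rpow_pos_of_pos hD (β - 1)
    rw [e2]
    field_simp
  rw [setLIntegral_congr_fun measurableSet_Ioo e, lintegral_const_mul' _ _ ENNReal.ofReal_ne_top,
    ← key, mul_one, hBsymm]

theorem fracJ_measurable {ψ p : ℝ → ℝ} (mψ : Measurable ψ) (mp : Measurable p) (c β : ℝ)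
    {U : ℝ → ℝ≥0∞} (hU : Measurable U) : Measurable (fracJ ψ p c β U) := by
  have : fracJ ψ p c β U = fun t => ∫⁻ s, {z : ℝ × ℝ | c < z.2 ∧ z.2 < z.1}.indicator
      (fun z => ENNReal.ofReal (p z.2) * (ENNReal.ofReal ((ψ z.1 - ψ z.2) ^ (β - 1)) * U z.2))
      (t, s) := by
    ext t
    rw [fracJ, ← lintegral_indicator measurableSet_Ioo]
    congr
  rw [this]
  refine Measurable.lintegral_prod_right' (f := {z : ℝ × ℝ | c < z.2 ∧ z.2 < z.1}.indicator
      (fun z => ENNReal.ofReal (p z.2) * (ENNReal.ofReal ((ψ z.1 - ψ z.2) ^ (β - 1)) * U z.2))) ?_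
  refine Measurable.indicator (by fun_prop) ?_
  exact (measurableSet_lt measurable_const measurable_snd).inter
    (measurableSet_lt measurable_snd measurable_fst)

theorem fracJ_semigroup {a b : ℝ} {ψ p : ℝ → ℝ} (h : GoodPsi a b ψ p) {α β : ℝ} (hα : 0 < α)
    (hβ : 0 < β) {c t : ℝ} (hac : a ≤ c) (htb : t ≤ b) {U : ℝ → ℝ≥0∞} (hU : Measurable U) :
    fracJ ψ p c α (fracJ ψ p c β U) t
      = ENNReal.ofReal (ProbabilityTheory.beta α β) * fracJ ψ p c (α + β) U t := by
  have mψ := h.mψ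
  have mp := h.mp
  let F : ℝ → ℝ → ℝ≥0∞ := fun τ s => {z : ℝ × ℝ | z.2 < z.1}.indicator
      (fun z => ENNReal.ofReal (p z.1) * (ENNReal.ofReal ((ψ t - ψ z.1) ^ (α - 1)) *
        (ENNReal.ofReal (p z.2) * (ENNReal.ofReal ((ψ z.1 - ψ z.2) ^ (β - 1)) * U z.2)))) (τ, s)
  have mF : Measurable (Function.uncurry F) := by
    have : Function.uncurry F = {z : ℝ × ℝ | z.2 < z.1}.indicator
      (fun z => ENNReal.ofReal (p z.1) * (ENNReal.ofReal ((ψ t - ψ z.1) ^ (α - 1)) *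
        (ENNReal.ofReal (p z.2) * (ENNReal.ofReal ((ψ z.1 - ψ z.2) ^ (β - 1)) * U z.2)))) := by
      ext ⟨x, y⟩; rfl
    rw [this]
    exact Measurable.indicator (by fun_prop) (measurableSet_lt measurable_snd measurable_fst)
  have e1 : fracJ ψ p c α (fracJ ψ p c β U) t
      = ∫⁻ τ in Ioo c t, ∫⁻ s in Ioo c t, F τ s := by
    rw [fracJ]
    refine setLIntegral_congr_fun measurableSet_Ioo fun τ hτ => ?_
    have : ∫⁻ s in Ioo c t, F τ s = ∫⁻ s in Ioo c τ, ENNReal.ofReal (p τ) *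
        (ENNReal.ofReal ((ψ t - ψ τ) ^ (α - 1)) *
        (ENNReal.ofReal (p s) * (ENNReal.ofReal ((ψ τ - ψ s) ^ (β - 1)) * U s))) := by
      rw [← lintegral_indicator measurableSet_Ioo, ← lintegral_indicator measurableSet_Ioo]
      congr 1
      ext s
      by_cases h1 : c < s <;> by_cases h2 : s < τ <;> by_cases h3 : s < t <;>
        simp [F, indicator, h1, h2, h3]
      exact absurd (h2.trans hτ.2) h3
    rw [this, lintegral_const_mul' _ _ ENNReal.ofReal_ne_top,
      lintegral_const_mul' _ _ ENNReal.ofReal_ne_top]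
    rfl
  rw [e1, lintegral_lintegral_swap mF.aemeasurable, fracJ,
    ← lintegral_const_mul' _ _ ENNReal.ofReal_ne_top]
  refine setLIntegral_congr_fun measurableSet_Ioo fun s hs => ?_
  have e2 : ∫⁻ τ in Ioo c t, F τ s = ∫⁻ τ in Ioo s t, (ENNReal.ofReal (p s) * U s) *
      (ENNReal.ofReal (p τ) * (ENNReal.ofReal ((ψ t - ψ τ) ^ (α - 1)) *
        ENNReal.ofReal ((ψ τ - ψ s) ^ (β - 1)))) := by
    rw [← lintegral_indicator measurableSet_Ioo, ← lintegral_indicator measurableSet_Ioo]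
    congr 1
    ext τ
    by_cases h1 : c < τ <;> by_cases h2 : s < τ <;> by_cases h3 : τ < t <;>
        simp [F, indicator, h1, h2, h3]
    · ring
    · exact absurd (hs.1.trans h2) h1
  rw [e2, lintegral_const_mul _ (by fun_prop), beta_kernel h hα hβ (hac.trans hs.1.le) hs.2 htb,
    ENNReal.ofReal_mul (ProbabilityTheory.beta_pos hα hβ).le]
  ring

theorem fracJ_const_mul (ψ p : ℝ → ℝ) (c β : ℝ) (U : ℝ → ℝ≥0∞) (t : ℝ) {r : ℝ≥0∞} (hr : r ≠ ∞) :
    fracJ ψ p c β (fun s => r * U s) t = r * fracJ ψ p c β U t := by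
  rw [fracJ, fracJ, ← lintegral_const_mul' _ _ hr]
  congr 1
  ext s
  ring

theorem fracJ_mono (ψ p : ℝ → ℝ) (c β : ℝ) {U V : ℝ → ℝ≥0∞} (t : ℝ)
    (h : ∀ s ∈ Ioo c t, U s ≤ V s) : fracJ ψ p c β U t ≤ fracJ ψ p c β V t := by
  refine setLIntegral_mono' measurableSet_Ioo fun s hs => ?_
  gcongr
  exact h s hs

theorem fracJ_anti (ψ p : ℝ → ℝ) {a c : ℝ} (hac : a ≤ c) (β : ℝ) (U : ℝ → ℝ≥0∞) (t : ℝ) :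
    fracJ ψ p c β U t ≤ fracJ ψ p a β U t :=
  lintegral_mono_set (Ioo_subset_Ioo_left hac)

noncomputable def gronV (ψ p g : ℝ → ℝ) (a α : ℝ) (U : ℝ → ℝ≥0∞) : ℕ → ℝ → ℝ≥0∞
  | 0 => U
  | k + 1 => fun t => ENNReal.ofReal (g t) * fracJ ψ p a α (gronV ψ p g a α U k) t

theorem gronV_measurable {ψ p g : ℝ → ℝ} (mψ : Measurable ψ) (mp : Measurable p)
    (mg : Measurable g) (a α : ℝ) {U : ℝ → ℝ≥0∞} (hU : Measurable U) (k : ℕ) :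
    Measurable (gronV ψ p g a α U k) := by
  induction k with
  | zero => exact hU
  | succ k ih => exact mg.ennreal_ofReal.mul (fracJ_measurable mψ mp _ _ ih)

theorem gron_const {α : ℝ} (hα : 0 < α) {k : ℕ} (hk : 1 ≤ k) :
    Gamma α ^ k / Gamma (α * k) * ProbabilityTheory.beta α (α * k)
      = Gamma α ^ (k + 1) / Gamma (α * (k + 1 : ℕ)) := by
  have hk' : (0 : ℝ) < k := by exact_mod_cast hk
  have h1 := Gamma_pos_of_pos (mul_pos hα hk')
  have h2 : α * ((k + 1 : ℕ) : ℝ) = α + α * k := by push_cast; ring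
  have h3 := Gamma_pos_of_pos (add_pos hα (mul_pos hα hk'))
  rw [h2, ProbabilityTheory.beta]
  field_simp
  ring

theorem gronV_upper {a b : ℝ} {ψ p g : ℝ → ℝ} (h : GoodPsi a b ψ p) {α : ℝ} (hα : 0 < α)
    (hg0 : ∀ t ∈ Icc a b, 0 ≤ g t) (hgm : MonotoneOn g (Icc a b))
    {U : ℝ → ℝ≥0∞} (hU : Measurable U) (k : ℕ) (hk : 1 ≤ k) :
    ∀ t ∈ Icc a b, gronV ψ p g a α U k t ≤
      ENNReal.ofReal (g t ^ k * (Gamma α ^ k / Gamma (α * k))) * fracJ ψ p a (α * k) U t := by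
  have hG := Gamma_pos_of_pos hα
  induction k, hk using Nat.le_induction with
  | base =>
    intro t ht
    simp [gronV, hG.ne']
  | succ k hk ih =>
    intro t ht
    have hk' : (0 : ℝ) < k := by exact_mod_cast hk
    have h1 := Gamma_pos_of_pos (mul_pos hα hk')
    have hgt := hg0 t ht
    have hB := ProbabilityTheory.beta_pos hα (mul_pos hα hk')
    calc gronV ψ p g a α U (k + 1) t
        = ENNReal.ofReal (g t) * fracJ ψ p a α (gronV ψ p g a α U k) t := rfl
      _ ≤ ENNReal.ofReal (g t) * fracJ ψ p a α (fun s =>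
            ENNReal.ofReal (g t ^ k * (Gamma α ^ k / Gamma (α * k))) *
              fracJ ψ p a (α * k) U s) t := by
          gcongr
          refine fracJ_mono _ _ _ _ _ fun s hs => ?_
          have hs' : s ∈ Icc a b := ⟨hs.1.le, hs.2.le.trans ht.2⟩
          refine (ih s hs').trans ?_
          have := hg0 s hs'
          have := hgm hs' ht hs.2.le
          gcongr
      _ = _ := by
          rw [fracJ_const_mul _ _ _ _ _ _ ENNReal.ofReal_ne_top,
            fracJ_semigroup h hα (mul_pos hα hk') le_rfl ht.2 hU, ← mul_assoc, ← mul_assoc,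
            ← ENNReal.ofReal_mul hgt, ← ENNReal.ofReal_mul (by positivity), ← gron_const hα hk]
          congr 2
          · ring
          · push_cast; ring

theorem gronV_lower {a b : ℝ} {ψ p g : ℝ → ℝ} (h : GoodPsi a b ψ p) {α : ℝ} (hα : 0 < α)
    {U : ℝ → ℝ≥0∞} (hU : Measurable U) {c t m : ℝ} (hac : a ≤ c) (htb : t ≤ b) (hm : 0 ≤ m)
    (hgm : ∀ x ∈ Icc c t, m ≤ g x) (k : ℕ) (hk : 1 ≤ k) :
    ∀ r ∈ Icc c t, ENNReal.ofReal (m ^ k * (Gamma α ^ k / Gamma (α * k))) *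
      fracJ ψ p c (α * k) U r ≤ gronV ψ p g a α U k r := by
  have hG := Gamma_pos_of_pos hα
  induction k, hk using Nat.le_induction with
  | base =>
    intro r hr
    have := hgm r hr
    simp only [gronV, hG.ne', pow_one, Nat.cast_one, mul_one, div_self, ne_eq, not_false_eq_true]
    gcongr
    exact fracJ_anti _ _ hac _ _ _
  | succ k hk ih =>
    intro r hr
    have hk' : (0 : ℝ) < k := by exact_mod_cast hk
    have h1 := Gamma_pos_of_pos (mul_pos hα hk')
    have hgt := hgm r hr
    have hB := ProbabilityTheory.beta_pos hα (mul_pos hα hk')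
    rw [← ge_iff_le]
    calc gronV ψ p g a α U (k + 1) r
        = ENNReal.ofReal (g r) * fracJ ψ p a α (gronV ψ p g a α U k) r := rfl
      _ ≥ ENNReal.ofReal m * fracJ ψ p c α (gronV ψ p g a α U k) r := by
          gcongr
          exact fracJ_anti _ _ hac _ _ _
      _ ≥ ENNReal.ofReal m * fracJ ψ p c α (fun s =>
            ENNReal.ofReal (m ^ k * (Gamma α ^ k / Gamma (α * k))) *
              fracJ ψ p c (α * k) U s) r := by
          gcongr
          exact fracJ_mono _ _ _ _ _ fun s hs => ih s ⟨hs.1.le, hs.2.le.trans hr.2⟩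
      _ = _ := by
          rw [fracJ_const_mul _ _ _ _ _ _ ENNReal.ofReal_ne_top,
            fracJ_semigroup h hα (mul_pos hα hk') hac (hr.2.trans htb) hU, ← mul_assoc,
            ← mul_assoc,
            ← ENNReal.ofReal_mul hm, ← ENNReal.ofReal_mul (by positivity), ← gron_const hα hk]
          congr 2
          · ring
          · push_cast; ring

theorem kernel_fin {a b : ℝ} {ψ p : ℝ → ℝ} (h : GoodPsi a b ψ p) {U : ℝ → ℝ≥0∞}
    (hUfin : ∫⁻ s in Ioo a b, U s ≠ ∞) {S : Set ℝ} (mS : MeasurableSet S) (hS : S ⊆ Ioo a b)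
    {t β K : ℝ} (hK : ∀ s ∈ S, (ψ t - ψ s) ^ (β - 1) ≤ K) :
    ∫⁻ s in S, ENNReal.ofReal (p s) * (ENNReal.ofReal ((ψ t - ψ s) ^ (β - 1)) * U s) ≠ ∞ := by
  obtain ⟨M, hM⟩ := h.bdd
  refine ne_top_of_le_ne_top ?_ (setLIntegral_mono' mS
    (g := fun s => ENNReal.ofReal M * (ENNReal.ofReal K * U s)) fun s hs => ?_)
  · rw [lintegral_const_mul' _ _ ENNReal.ofReal_ne_top,
      lintegral_const_mul' _ _ ENNReal.ofReal_ne_top]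
    exact ENNReal.mul_ne_top ENNReal.ofReal_ne_top (ENNReal.mul_ne_top ENNReal.ofReal_ne_top
      (ne_top_of_le_ne_top hUfin (lintegral_mono_set hS)))
  · have := hM s (hS hs)
    have := hK s hs
    gcongr

theorem fracJ_ae_fin {a b : ℝ} {ψ p : ℝ → ℝ} (hab : a < b) (h : GoodPsi a b ψ p)
    {U : ℝ → ℝ≥0∞} (hU : Measurable U)
    (hUfin : ∫⁻ s in Ioo a b, U s ≠ ∞) {β : ℝ} (hβ : 0 < β) :
    ∀ᵐ s ∂(volume.restrict (Ioo a b)), fracJ ψ p a β U s < ∞ := by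
  have mψ := h.mψ
  have mp := h.mp
  have mJ := fracJ_measurable mψ mp a β hU
  have h1 : fracJ ψ p a 1 (fracJ ψ p a β U) b ≠ ∞ := by
    rw [fracJ_semigroup h one_pos hβ le_rfl le_rfl hU]
    refine ENNReal.mul_ne_top ENNReal.ofReal_ne_top ?_
    refine kernel_fin h hUfin measurableSet_Ioo subset_rfl (K := (ψ b - ψ a) ^ (1 + β - 1)) ?_
    intro s hs
    have h1 := h.mono.monotoneOn (left_mem_Icc.2 hab.le) (Ioo_subset_Icc_self hs) hs.1.le
    have h2 := h.mono.monotoneOn (Ioo_subset_Icc_self hs) (right_mem_Icc.2 hab.le) hs.2.le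
    exact rpow_le_rpow (by linarith) (by linarith) (by linarith)
  have h2 := ae_lt_top (by fun_prop) h1
  filter_upwards [h2, ae_restrict_mem measurableSet_Ioo] with s hs hm
  by_contra hc
  have hc' : fracJ ψ p a β U s = ∞ := by simpa using hc
  have := h.pos s hm
  simp [hc', ENNReal.mul_top, this] at hs

theorem fracJ_local {a b : ℝ} {ψ p : ℝ → ℝ} (h : GoodPsi a b ψ p) {U : ℝ → ℝ≥0∞}
    (hUfin : ∫⁻ s in Ioo a b, U s ≠ ∞) {c t β : ℝ} (hac : a < c) (hct : c < t) (htb : t ≤ b)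
    (htop : fracJ ψ p a β U t = ∞) : fracJ ψ p c β U t = ∞ := by
  by_contra hne
  rw [fracJ, ← Ioc_union_Ioo_eq_Ioo hac.le hct] at htop
  have hdis : ∫⁻ s in Ioc a c, ENNReal.ofReal (p s) *
      (ENNReal.ofReal ((ψ t - ψ s) ^ (β - 1)) * U s) ≠ ∞ := by
    have hcm : c ∈ Icc a b := ⟨hac.le, by linarith⟩
    have htm : t ∈ Icc a b := ⟨by linarith, htb⟩
    have h0 := h.mono hcm htm hct
    refine kernel_fin h hUfin measurableSet_Ioc (fun x hx => ⟨hx.1, by linarith [hx.2]⟩)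
      (K := (ψ t - ψ a) ^ (β - 1) + (ψ t - ψ c) ^ (β - 1)) ?_
    intro s hs
    have hsm : s ∈ Icc a b := ⟨hs.1.le, hs.2.trans hcm.2⟩
    have ham : a ∈ Icc a b := ⟨le_rfl, by linarith⟩
    have h1 := h.mono.monotoneOn ham hsm hs.1.le
    have h2 := h.mono.monotoneOn hsm hcm hs.2
    have p1 : 0 ≤ (ψ t - ψ a) ^ (β - 1) := rpow_nonneg (by linarith) _
    have p2 : 0 ≤ (ψ t - ψ c) ^ (β - 1) := rpow_nonneg (by linarith) _
    rcases le_total 0 (β - 1) with hb | hb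
    · have := rpow_le_rpow (z := β - 1) (by linarith) (show ψ t - ψ s ≤ ψ t - ψ a by linarith) hb
      linarith
    · have := rpow_le_rpow_of_nonpos (z := β - 1) (show 0 < ψ t - ψ c by linarith)
        (show ψ t - ψ c ≤ ψ t - ψ s by linarith) hb
      linarith
  have hle := lintegral_union_le (μ := volume) (fun s => ENNReal.ofReal (p s) *
      (ENNReal.ofReal ((ψ t - ψ s) ^ (β - 1)) * U s)) (Ioc a c) (Ioo c t)
  rw [htop, top_le_iff, ENNReal.add_eq_top] at hle
  exact hle.elim hdis hne

theorem gron_bridge {a b : ℝ} {ψ ψe p : ℝ → ℝ} (h : GoodPsi a b ψe p)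
    (he : ∀ x ∈ Icc a b, ψe x = ψ x) {φ : ℝ → ℝ} (hφ : ∀ x ∈ Icc a b, 0 ≤ φ x)
    {U : ℝ → ℝ≥0∞} (hU : Measurable U)
    (hφU : ∀ᵐ x ∂(volume.restrict (Ioo a b)), ENNReal.ofReal (φ x) = U x)
    (β : ℝ) {t : ℝ} (ht : t ∈ Icc a b) :
    ∫ τ in a..t, p τ * (ψ t - ψ τ) ^ (β - 1) * φ τ = (fracJ ψe p a β U t).toReal := by
  have mψ := h.mψ
  have mp := h.mp
  rw [intervalIntegral.integral_of_le ht.1, integral_Ioc_eq_integral_Ioo]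
  have hsub : Ioo a t ⊆ Ioo a b := Ioo_subset_Ioo_right ht.2
  have hφU' := ae_restrict_of_ae_restrict_of_subset hsub hφU
  have e1 : ∫ τ in Ioo a t, p τ * (ψ t - ψ τ) ^ (β - 1) * φ τ
      = ∫ τ in Ioo a t, p τ * (ψe t - ψe τ) ^ (β - 1) * (U τ).toReal := by
    apply integral_congr_ae
    filter_upwards [hφU', ae_restrict_mem measurableSet_Ioo] with x hx hm
    have hx' := Ioo_subset_Icc_self (hsub hm)
    rw [← hx, ENNReal.toReal_ofReal (hφ x hx'), he t ht, he x hx']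
  have hnn : ∀ x ∈ Ioo a t, 0 ≤ p x * (ψe t - ψe x) ^ (β - 1) := by
    intro x hx
    have h1 := h.mono.monotoneOn (Ioo_subset_Icc_self (hsub hx)) ht hx.2.le
    exact mul_nonneg (h.pos x (hsub hx)).le (rpow_nonneg (by linarith) _)
  rw [e1, integral_eq_lintegral_of_nonneg_ae]
  · rw [fracJ]
    congr 1
    apply lintegral_congr_ae
    filter_upwards [hφU', ae_restrict_mem measurableSet_Ioo] with x hx hm
    rw [ENNReal.ofReal_mul (hnn x hm), ENNReal.ofReal_mul (h.pos x (hsub hm)).le,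
      ENNReal.ofReal_toReal (by rw [← hx]; exact ENNReal.ofReal_ne_top), mul_assoc]
  · filter_upwards [ae_restrict_mem measurableSet_Ioo] with x hm
    exact mul_nonneg (hnn x hm) ENNReal.toReal_nonneg
  · exact Measurable.aestronglyMeasurable (by fun_prop)

theorem goodPsi_of {a b : ℝ} (hab : a < b) {ψ : ℝ → ℝ}
    (hψ : ContDiffOn ℝ 1 ψ (Set.Icc a b)) (hmono : StrictMonoOn ψ (Set.Icc a b))
    (hψ' : ∀ x ∈ Set.Icc a b, deriv ψ x ≠ 0) :
    GoodPsi a b (IccExtend hab.le ((Icc a b).domRestrict ψ)) (deriv ψ) := by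
  have he : ∀ x ∈ Icc a b, IccExtend hab.le ((Icc a b).domRestrict ψ) x = ψ x := fun x hx =>
    IccExtend_of_mem hab.le _ hx
  have hc : Continuous (IccExtend hab.le ((Icc a b).domRestrict ψ)) :=
    hψ.continuousOn.domRestrict.Icc_extend'
  have hdw : ∀ x ∈ Ioo a b, derivWithin ψ (Icc a b) x = deriv ψ x := fun x hx =>
    derivWithin_of_mem_nhds (Icc_mem_nhds hx.1 hx.2)
  refine ⟨hc.measurable, measurable_deriv ψ, ?_, hc.continuousOn, ?_, ?_, ?_⟩
  · intro x hx y hy hxy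
    rw [he x hx, he y hy]
    exact hmono hx hy hxy
  · intro x hx
    have h1 : DifferentiableAt ℝ ψ x :=
      (hψ.differentiableOn one_ne_zero).differentiableAt (Icc_mem_nhds hx.1 hx.2)
    refine h1.hasDerivAt.congr_of_eventuallyEq ?_
    filter_upwards [Icc_mem_nhds hx.1 hx.2] with y hy using he y hy
  · intro x hx
    refine lt_of_le_of_ne ?_ (hψ' x (Ioo_subset_Icc_self hx)).symm
    rw [← hdw x hx]
    exact hmono.monotoneOn.derivWithin_nonneg
  · obtain ⟨M, hM⟩ := isCompact_Icc.exists_bound_of_continuousOn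
      (hψ.continuousOn_derivWithin (uniqueDiffOn_Icc hab) le_rfl)
    refine ⟨M, fun x hx => ?_⟩
    have := hM x (Ioo_subset_Icc_self hx)
    rw [hdw x hx] at this
    exact (le_abs_self _).trans this

theorem gron_iter {a b α : ℝ} {u g ge ψ ψe : ℝ → ℝ} (hab : a < b) (hα : 0 < α)
    (mge : Measurable ge) (hge : ∀ x ∈ Icc a b, ge x = g x)
    (hg0 : ∀ t ∈ Icc a b, 0 ≤ g t) (hgmono : MonotoneOn g (Icc a b))
    (h : GoodPsi a b ψe (deriv ψ)) (he : ∀ x ∈ Icc a b, ψe x = ψ x)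
    (hu0 : ∀ t ∈ Icc a b, 0 ≤ u t) {U : ℝ → ℝ≥0∞} (hU : Measurable U)
    (hUfin : ∫⁻ s in Ioo a b, U s ≠ ∞)
    (huU : ∀ᵐ x ∂(volume.restrict (Ioo a b)), ENNReal.ofReal (u x) = U x) (k : ℕ) :
    (∀ t ∈ Icc a b, 0 ≤ (gronOp a α g ψ)^[k] u t) ∧
    (∀ᵐ x ∂(volume.restrict (Ioo a b)), ENNReal.ofReal ((gronOp a α g ψ)^[k] u x)
      = gronV ψe (deriv ψ) ge a α U k x) ∧
    (1 ≤ k → ∀ t ∈ Icc a b, (gronOp a α g ψ)^[k] u t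
      = (gronV ψe (deriv ψ) ge a α U k t).toReal) := by
  have hge0 : ∀ t ∈ Icc a b, 0 ≤ ge t := fun t ht => by rw [hge t ht]; exact hg0 t ht
  have hgem : MonotoneOn ge (Icc a b) := fun x hx y hy hxy => by
    rw [hge x hx, hge y hy]; exact hgmono hx hy hxy
  induction k with
  | zero => exact ⟨hu0, huU, fun h0 => absurd h0 (by norm_num)⟩
  | succ k ih =>
    obtain ⟨i1, i2, -⟩ := ih
    have main : ∀ t ∈ Icc a b, (gronOp a α g ψ)^[k + 1] u t
        = (gronV ψe (deriv ψ) ge a α U (k + 1) t).toReal := by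
      intro t ht
      rw [Function.iterate_succ_apply', gronOp,
        gron_bridge h he i1 (gronV_measurable h.mψ h.mp mge a α hU k) i2 α ht, gronV,
        ENNReal.toReal_mul, ENNReal.toReal_ofReal (hge0 t ht), hge t ht]
    refine ⟨fun t ht => by rw [main t ht]; exact ENNReal.toReal_nonneg, ?_, fun _ => main⟩
    filter_upwards [fracJ_ae_fin hab h hU hUfin (β := α * (k + 1 : ℕ)) (by positivity),
      ae_restrict_mem measurableSet_Ioo] with x hx hm
    have hm' := Ioo_subset_Icc_self hm
    rw [main x hm', ENNReal.ofReal_toReal]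
    exact ne_top_of_le_ne_top (ENNReal.mul_ne_top ENNReal.ofReal_ne_top hx.ne)
      (gronV_upper h hα hge0 hgem hU (k + 1) (by omega) x hm')

theorem stmt6 (a b α : ℝ) (u g ψ : ℝ → ℝ) (hab : a < b) (hα : 0 < α)
    (hg : ContinuousOn g (Set.Icc a b))
    (hg0 : ∀ t ∈ Set.Icc a b, 0 ≤ g t) (hgmono : MonotoneOn g (Set.Icc a b))
    (hψ : ContDiffOn ℝ 1 ψ (Set.Icc a b)) (hmono : StrictMonoOn ψ (Set.Icc a b))
    (hψ' : ∀ x ∈ Set.Icc a b, deriv ψ x ≠ 0)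
    (hu : IntervalIntegrable u volume a b) (hu0 : ∀ t ∈ Set.Icc a b, 0 ≤ u t) :
    ∀ k : ℕ, 1 ≤ k → ∀ t ∈ Set.Icc a b,
      (gronOp a α g ψ)^[k] u t ≤
        ∫ τ in a..t, (g t * Real.Gamma α) ^ k / Real.Gamma (α * k) *
          (deriv ψ τ * (ψ t - ψ τ) ^ (α * k - 1) * u τ) := by
  intro k hk t ht
  have h := goodPsi_of hab hψ hmono hψ'
  have he : ∀ x ∈ Icc a b, IccExtend hab.le ((Icc a b).domRestrict ψ) x = ψ x := fun x hx =>
    IccExtend_of_mem hab.le _ hx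
  generalize IccExtend hab.le ((Icc a b).domRestrict ψ) = ψe at h he
  obtain ⟨ge, hgec, hge⟩ : ∃ ge : ℝ → ℝ, Continuous ge ∧ ∀ x ∈ Icc a b, ge x = g x :=
    ⟨IccExtend hab.le ((Icc a b).domRestrict g), hg.domRestrict.Icc_extend', fun x hx =>
      IccExtend_of_mem hab.le _ hx⟩
  have hge0 : ∀ t ∈ Icc a b, 0 ≤ ge t := fun t ht => by rw [hge t ht]; exact hg0 t ht
  have hgem : MonotoneOn ge (Icc a b) := fun x hx y hy hxy => by
    rw [hge x hx, hge y hy]; exact hgmono hx hy hxy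
  have hui : IntegrableOn u (Ioo a b) :=
    ((intervalIntegrable_iff_integrableOn_Ioc_of_le hab.le).1 hu).mono_set Ioo_subset_Ioc_self
  have haem : AEMeasurable (fun x => ENNReal.ofReal (u x)) (volume.restrict (Ioo a b)) :=
    hui.aestronglyMeasurable.aemeasurable.ennreal_ofReal
  obtain ⟨U, hU, huU⟩ := haem
  have hUfin : ∫⁻ s in Ioo a b, U s ≠ ∞ := by
    rw [← lintegral_congr_ae huU]
    exact ne_top_of_le_ne_top hui.2.ne (lintegral_mono fun x => by
      rw [← ofReal_norm]
      exact ENNReal.ofReal_le_ofReal (le_abs_self _))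
  have hk' : (0 : ℝ) < k := by exact_mod_cast hk
  have hG := Gamma_pos_of_pos hα
  have hGk := Gamma_pos_of_pos (mul_pos hα hk')
  have hgt := hge0 t ht
  rw [intervalIntegral.integral_const_mul, gron_bridge h he hu0 hU huU (α * k) ht,
    (gron_iter hab hα hgec.measurable hge hg0 hgmono h he hu0 hU hUfin huU k).2.2 hk t ht,
    ← hge t ht]
  have hup := gronV_upper h hα hge0 hgem hU k hk t ht
  have hR : (ge t * Gamma α) ^ k / Gamma (α * k) * (fracJ ψe (deriv ψ) a (α * k) U t).toReal
      = (ENNReal.ofReal (ge t ^ k * (Gamma α ^ k / Gamma (α * k))) *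
        fracJ ψe (deriv ψ) a (α * k) U t).toReal := by
    rw [ENNReal.toReal_mul, ENNReal.toReal_ofReal (by positivity)]
    ring
  by_cases htop : fracJ ψe (deriv ψ) a (α * k) U t = ∞
  · rcases hgt.eq_or_lt with hz | hpos
    · obtain ⟨j, rfl⟩ : ∃ j, k = j + 1 := ⟨k - 1, by omega⟩
      simp [gronV, ← hz]
    · have hat : a < t := by
        rcases ht.1.eq_or_lt with h0 | h0
        · rw [← h0] at htop
          simp [fracJ] at htop
        · exact h0
      obtain ⟨ε, hε, hball⟩ := Metric.continuousAt_iff.1 (hgec.continuousAt (x := t)) (ge t / 2)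
        (half_pos hpos)
      set c := max ((a + t) / 2) (t - ε / 2) with hc
      have hac : a < c := lt_max_of_lt_left (by linarith)
      have hct : c < t := max_lt (by linarith) (by linarith)
      have hm : ∀ x ∈ Icc c t, ge t / 2 ≤ ge x := by
        intro x hx
        have h1 : t - ε / 2 ≤ x := (le_max_right _ _).trans hx.1
        have h2 : dist x t < ε := by
          rw [Real.dist_eq, abs_lt]; constructor <;> linarith [hx.2]
        have h3 := hball h2
        rw [Real.dist_eq, abs_lt] at h3
        linarith [h3.1]
      have hlow := gronV_lower h hα hU hac.le ht.2 (half_pos hpos).le hm k hk t ⟨hct.le, le_rfl⟩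
      rw [fracJ_local h hUfin hac hct ht.2 htop, ENNReal.mul_top, top_le_iff] at hlow
      · rw [hlow, htop]; simp
      · rw [Ne, ENNReal.ofReal_eq_zero, not_le]; positivity
  · rw [hR]
    exact ENNReal.toReal_mono (ENNReal.mul_ne_top ENNReal.ofReal_ne_top htop) hup
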